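/- Take B := β and let act : α → ((B → Res W) → Res W) be any injective function (in the translation from Core Eff to Core delimcc, act v = fun k' => V (Act (v, k')), which is injective since v is recoverable by applying the body to any continuation). Define, for each type A, the map ι : ResE A → Res A by ι (V a) = V a and ι (E i v k) = E i (act v) (fun b => ι (k b)). Then: (a) ι is injective, so the Core Eff result domain ResE A is isomorphic to its image inside the Core delimcc result domain Res A (the sub-collection of results all of whose bubbles have bodies in the image of act); and (b) ι commutes with the liftings: ι (liftE f r) = lift (fun a => ι (f a)) (ι r) for all f : A → ResE C and r : ResE A. -/

import Mathlib

/-!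
The Core delimcc result domain `Res` (with continuation-value type `B := β`
and the body type of `shift0` abstracted as `Bd`, since the true body type
`(B → Res W) → Res W` is a non-strictly-positive recursion; in the translation
from Core Eff a body is `act v = fun k' => V (Act (v, k'))`, represented here
by an injective `act : α → Bd`), the Core Eff result domain `ResE`, their
liftings, and the map `ι`.
-/

inductive Res (B Bd A : Type) : Type where
  | V : A → Res B Bd A
  | E : ℕ → Bd → (B → Res B Bd A) → Res B Bd A

def Res.lift {B Bd A C : Type} (f : A → Res B Bd C) : Res B Bd A → Res B Bd C
  | .V a => f a
  | .E p bd k => .E p bd (fun b => Res.lift f (k b))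

inductive ResE (α β A : Type) : Type where
  | V : A → ResE α β A
  | E : ℕ → α → (β → ResE α β A) → ResE α β A

def ResE.liftE {α β A C : Type} (f : A → ResE α β C) : ResE α β A → ResE α β C
  | .V a => f a
  | .E i v k => .E i v (fun b => ResE.liftE f (k b))

/-- The map `ι : ResE A → Res A` (with `B := β`):
`ι (V a) = V a` and `ι (E i v k) = E i (act v) (fun b => ι (k b))`. -/
def iota {α β Bd : Type} (act : α → Bd) {A : Type} : ResE α β A → Res β Bd A
  | .V a => .V a
  | .E i v k => .E i (act v) (fun b => iota act (k b))

theorem iota_injective {α β Bd A : Type} {act : α → Bd} (hact : Function.Injective act) :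
    Function.Injective (iota (β := β) (A := A) act) := by
  intro r
  induction r with
  | V a =>
    rintro (a' | ⟨j, w, l⟩) h
    · cases h
      rfl
    · cases h
  | E i v k ih =>
    rintro (a' | ⟨j, w, l⟩) h
    · cases h
    · simp only [iota, Res.E.injEq] at h
      obtain ⟨rfl, hvw, hkl⟩ := h
      obtain rfl := hact hvw
      obtain rfl : k = l := funext fun b => ih b (congrFun hkl b)
      rfl

theorem iota_liftE {α β Bd A C : Type} (act : α → Bd) (f : A → ResE α β C) (r : ResE α β A) :
    iota act (ResE.liftE f r) = Res.lift (fun a => iota act (f a)) (iota act r) := by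
  induction r with
  | V a => rfl
  | E i v k ih => simp only [ResE.liftE, iota, Res.lift, ih]

/-- With `B := β` and `act` any injective function (in the translation from
Core Eff to Core delimcc, `act v = fun k' => V (Act (v, k'))`, which is
injective): (a) `ι` is injective, so the Core Eff result domain `ResE A` is
isomorphic to its image inside the Core delimcc result domain `Res A` (the
sub-collection of results all of whose bubbles have bodies in the image of
`act`); and (b) `ι` commutes with the liftings:
`ι (liftE f r) = lift (fun a => ι (f a)) (ι r)`. -/
theorem iota_injective_and_lift {α β Bd : Type}
    (act : α → Bd) (hact : Function.Injective act) :
    (∀ A : Type, Function.Injective (iota (α := α) (β := β) (Bd := Bd) (A := A) act)) ∧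
    (∀ (A C : Type) (f : A → ResE α β C) (r : ResE α β A),
        iota act (ResE.liftE f r) = Res.lift (fun a => iota act (f a)) (iota act r)) :=
  ⟨fun _ => iota_injective hact, fun _ _ => iota_liftE act⟩
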